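/- arXiv:2308.12541 — 4 statements merged into one kernel-verified Lean document; each statement's English description precedes it below -/
import Mathlib

section
/- Let F be a group, L a normal subgroup of F, R a subset of L, and N the normal closure of R in F (so N ≤ L and N is normal in F). Suppose N surjects onto the abelianization L/[L,L] under the quotient map, i.e. L = N ⊔ [L,L]. Then the image of L in F/N, namely the kernel of the induced surjection F/N → F/L, is a perfect normal subgroup of F/N. -/
/-- Let `L` be a normal subgroup of `F`, `R ⊆ L` a subset, and
`N = normalClosure R` (so `N ≤ L` and `N ◁ F`).  If `N` surjects onto the abelianization
`L/[L,L]`, i.e. `N ⊔ ⁅L, L⁆ = L`, then the image of `L` in `F ⧸ N` — which is the kernel of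
the induced surjection `F ⧸ N → F ⧸ L` — is a perfect normal subgroup of `F ⧸ N`. -/
theorem stmt_5 {F : Type*} [Group F] (L : Subgroup F) [L.Normal] (R : Set F)
    (hR : R ⊆ (L : Set F))
    (hsurj : Subgroup.normalClosure R ⊔ ⁅L, L⁆ = L) :
    (L.map (QuotientGroup.mk' (Subgroup.normalClosure R))).Normal ∧
    ⁅L.map (QuotientGroup.mk' (Subgroup.normalClosure R)),
        L.map (QuotientGroup.mk' (Subgroup.normalClosure R))⁆
      = L.map (QuotientGroup.mk' (Subgroup.normalClosure R)) ∧
    L.map (QuotientGroup.mk' (Subgroup.normalClosure R))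
      = (QuotientGroup.map (Subgroup.normalClosure R) L (MonoidHom.id F)
          (by simpa using Subgroup.normalClosure_le_normal hR)).ker := by
  refine ⟨‹L.Normal›.map _ (QuotientGroup.mk'_surjective _), ?_, ?_⟩
  · have h_map_normalClosure : (Subgroup.normalClosure R).map
        (QuotientGroup.mk' (Subgroup.normalClosure R)) = ⊥ := by
      rw [Subgroup.map_eq_bot_iff, QuotientGroup.ker_mk']
    rw [← Subgroup.map_commutator]
    conv_rhs => rw [← hsurj, Subgroup.map_sup, h_map_normalClosure, bot_sup_eq]
  · rw [QuotientGroup.ker_map, Subgroup.comap_id]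
end

section
/- Let E be a finitely generated group and K a normal subgroup of E such that the quotient E/K is finitely presented. Then K is finitely closed in E: there exists a finite subset S of K such that K is the normal closure of S in E. -/
/-- If a homomorphism `φ` from a group `F` to a finitely generated group `E` induces a surjection
`F → E ⧸ K` whose kernel is the normal closure of a finite set, then `K` is the normal closure
of a finite set. -/
theorem exists_finset_normalClosure_eq_of_surjective_comp_mk {E F : Type*} [Group E] [Group.FG E]
    [Group F] (K : Subgroup E) [K.Normal] (φ : F →* E)
    (hφ : Function.Surjective ((QuotientGroup.mk' K).comp φ)) {R : Set F} (hR : R.Finite)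
    (hker : ((QuotientGroup.mk' K).comp φ).ker = Subgroup.normalClosure R) :
    ∃ S : Finset E, (S : Set E) ⊆ (K : Set E) ∧ Subgroup.normalClosure (S : Set E) = K := by
  classical
  have hφK (x : F) : x ∈ Subgroup.normalClosure R ↔ φ x ∈ K := by
    simp [← hker, MonoidHom.mem_ker]
  obtain ⟨T, hT⟩ := Group.FG.out (G := E)
  choose w hw using fun e : E => hφ (QuotientGroup.mk' K e)
  have hwK (e : E) : (φ (w e))⁻¹ * e ∈ K := QuotientGroup.eq.mp (hw e)
  let S : Finset E := hR.toFinset.image φ ∪ T.image fun t => (φ (w t))⁻¹ * t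
  have hSK : (S : Set E) ⊆ K := by
    intro x hx
    simp only [S, Finset.coe_union, Finset.coe_image, Set.Finite.coe_toFinset] at hx
    rcases hx with ⟨y, hy, rfl⟩ | ⟨t, -, rfl⟩
    · exact (hφK y).mp (Subgroup.subset_normalClosure hy)
    · exact hwK t
  refine ⟨S, hSK, le_antisymm (Subgroup.normalClosure_le_normal hSK) fun k hk => ?_⟩
  set N := Subgroup.normalClosure (S : Set E)
  have hRN : Subgroup.normalClosure R ≤ N.comap φ :=
    Subgroup.normalClosure_le_normal fun y hy => Subgroup.subset_normalClosure <| by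
      simpa [S] using Or.inl ⟨y, hy, rfl⟩
  have htop : φ.range ⊔ N = ⊤ := by
    rw [eq_top_iff, ← hT, Subgroup.closure_le]
    intro t ht
    have htN : (φ (w t))⁻¹ * t ∈ N := Subgroup.subset_normalClosure <| by
      simpa [S] using Or.inr ⟨t, ht, rfl⟩
    simpa using Subgroup.mul_mem_sup (show φ (w t) ∈ φ.range from ⟨w t, rfl⟩) htN
  obtain ⟨_, ⟨x, rfl⟩, n, hn, rfl⟩ :=
    Subgroup.mem_sup_of_normal_right.mp (htop ▸ Subgroup.mem_top k)
  have hnK : n ∈ K := Subgroup.normalClosure_le_normal hSK hn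
  exact N.mul_mem (hRN ((hφK x).mpr ((K.mul_mem_cancel_right hnK).mp hk))) hn

/-- Let `E` be a finitely generated group and `K` a normal subgroup such that
`E ⧸ K` is finitely presented (isomorphic to a quotient of a finitely generated free group by
the normal closure of finitely many relators).  Then `K` is finitely closed in `E`: it is the
normal closure in `E` of a finite subset of `K`. -/
theorem stmt_6 {E : Type*} [Group E] [Group.FG E] (K : Subgroup E) [K.Normal]
    (hfp : ∃ (n m : ℕ) (r : Fin m → FreeGroup (Fin n)),
      Nonempty ((FreeGroup (Fin n) ⧸ Subgroup.normalClosure (Set.range r)) ≃* (E ⧸ K))) :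
    ∃ S : Finset E, (S : Set E) ⊆ (K : Set E) ∧
      Subgroup.normalClosure (S : Set E) = K := by
  obtain ⟨n, m, r, ⟨e⟩⟩ := hfp
  let p : FreeGroup (Fin n) →* E ⧸ K := e.toMonoidHom.comp (QuotientGroup.mk' _)
  have hp : Function.Surjective p := e.surjective.comp (QuotientGroup.mk'_surjective _)
  choose f hf using fun i => QuotientGroup.mk'_surjective K (p (FreeGroup.of i))
  have hcomp : (QuotientGroup.mk' K).comp (FreeGroup.lift f) = p := by
    ext i
    simpa using hf i
  refine exists_finset_normalClosure_eq_of_surjective_comp_mk K (FreeGroup.lift f)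
    (hcomp ▸ hp) (Set.finite_range r) ?_
  ext x
  simp [hcomp, p]
end

section
/- Let E be a group, K a normal subgroup of E, and k₁,…,k_r elements of K such that K is generated by the commutator subgroup [K,K] together with the normal closure K' of {k₁,…,k_r} in E (i.e. K = K' ⊔ [K,K]). Then K' ≤ K, the subgroup K/K' is a perfect normal subgroup of E/K', and the natural map (E/K')/(K/K') → E/K is an isomorphism of groups. -/
/-- Let `K ◁ E` and let `k₁, …, k_r ∈ K` be such that `K` is generated by
its commutator subgroup together with the normal closure `K'` of `{k₁, …, k_r}` in `E`
(i.e. `K' ⊔ ⁅K, K⁆ = K`).  Then `K' ≤ K`, the image `K/K'` of `K` in `E ⧸ K'` is a perfect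
normal subgroup of `E ⧸ K'`, and the natural map `(E ⧸ K') ⧸ (K/K') → E ⧸ K` is an
isomorphism (i.e. bijective). -/
theorem stmt_7 {E : Type*} [Group E] (K : Subgroup E) [K.Normal] {r : ℕ}
    (k : Fin r → E) (hk : ∀ i, k i ∈ K)
    (hgen : Subgroup.normalClosure (Set.range k) ⊔ ⁅K, K⁆ = K) :
    ∃ h : Subgroup.normalClosure (Set.range k) ≤ K,
      (K.map (QuotientGroup.mk' (Subgroup.normalClosure (Set.range k)))).Normal ∧
      ⁅K.map (QuotientGroup.mk' (Subgroup.normalClosure (Set.range k))),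
          K.map (QuotientGroup.mk' (Subgroup.normalClosure (Set.range k)))⁆
        = K.map (QuotientGroup.mk' (Subgroup.normalClosure (Set.range k))) ∧
      Function.Bijective
        (QuotientGroup.quotientQuotientEquivQuotientAux
          (Subgroup.normalClosure (Set.range k)) K h) := by
  have h : Subgroup.normalClosure (Set.range k) ≤ K :=
    Subgroup.normalClosure_le_normal (Set.range_subset_iff.2 hk)
  refine ⟨h, inferInstance, ?_,
    (QuotientGroup.quotientQuotientEquivQuotient _ K h).bijective⟩
  rw [← Subgroup.map_commutator]
  conv_rhs => rw [← hgen, Subgroup.map_sup, QuotientGroup.map_mk'_self, bot_sup_eq]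
end

section
/- Let G be a group admitting a finite presentation with n generators and m relators, i.e. G is isomorphic to the quotient of FreeGroup (Fin n) by the normal closure of the range of a function Fin m → FreeGroup (Fin n). Then the deficiency n − m is bounded above by the rank of the abelianization of G: (n : ℤ) − m ≤ dim_ℚ (ℚ ⊗_ℤ G^{ab}), where G^{ab} = G/[G,G] is regarded as a ℤ-module. -/
open scoped TensorProduct

/-- The exponent-sum homomorphism from a free group to the rational vector space on its
generators. -/
def FreeGroup.exponentSum (n : ℕ) : FreeGroup (Fin n) →* Multiplicative (Fin n → ℚ) :=
  FreeGroup.lift fun i => Multiplicative.ofAdd (Pi.single i 1)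

/-- A homomorphism from a group to a rational vector space extends to the rationalization of
the abelianization. -/
theorem Abelianization.exists_linearMap_rat {G V : Type*} [Group G] [AddCommGroup V] [Module ℚ V]
    (f : G →* Multiplicative V) :
    ∃ L : ℚ ⊗[ℤ] Additive (Abelianization G) →ₗ[ℚ] V,
      ∀ g : G, L (1 ⊗ₜ Additive.ofMul (Abelianization.of g)) = (f g).toAdd := by
  let a : Additive (Abelianization G) →+ V := MonoidHom.toAdditiveLeft (Abelianization.lift f)
  refine ⟨a.toIntLinearMap.liftBaseChange ℚ, fun g => ?_⟩
  simp [a]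

/-- The rationalization of the abelianization of a finitely generated group is
finite-dimensional. -/
theorem Abelianization.finite_rat_tensorProduct (G : Type*) [Group G] [Group.FG G] :
    Module.Finite ℚ (ℚ ⊗[ℤ] Additive (Abelianization G)) := by
  have : Group.FG (Abelianization G) :=
    Group.fg_of_surjective (f := Abelianization.of) Quotient.mk_surjective
  have : Module.Finite ℤ (Additive (Abelianization G)) :=
    Module.Finite.iff_addGroup_fg.2 inferInstance
  infer_instance

/-- If a group `G` admits a finite presentation with `n` generators and `m`
relators, then the deficiency `n - m` is bounded above by the rank of the abelianization of
`G`, i.e. by `dim_ℚ (ℚ ⊗_ℤ G^{ab})`. -/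
theorem stmt_8 {G : Type*} [Group G] (n m : ℕ) (r : Fin m → FreeGroup (Fin n))
    (e : G ≃* (FreeGroup (Fin n) ⧸ Subgroup.normalClosure (Set.range r))) :
    (n : ℤ) - m ≤ (Module.finrank ℚ (ℚ ⊗[ℤ] Additive (Abelianization G)) : ℤ) := by
  have : Group.FG G := Group.fg_of_surjective (f := e.symm.toMonoidHom) e.symm.surjective
  have := Abelianization.finite_rat_tensorProduct G
  let S : Submodule ℚ (Fin n → ℚ) :=
    Submodule.span ℚ (Set.range fun j => (FreeGroup.exponentSum n (r j)).toAdd)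
  have hS : Module.finrank ℚ S ≤ m :=
    (finrank_range_le_card (R := ℚ) fun j => (FreeGroup.exponentSum n (r j)).toAdd).trans_eq
      (Fintype.card_fin m)
  have hQ : Module.finrank ℚ ((Fin n → ℚ) ⧸ S) + Module.finrank ℚ S = n := by
    simpa using S.finrank_quotient_add_finrank
  let f : FreeGroup (Fin n) →* Multiplicative ((Fin n → ℚ) ⧸ S) :=
    (AddMonoidHom.toMultiplicative S.mkQ.toAddMonoidHom).comp (FreeGroup.exponentSum n)
  have hf : Subgroup.normalClosure (Set.range r) ≤ f.ker := by
    refine Subgroup.normalClosure_le_normal ?_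
    rintro _ ⟨j, rfl⟩
    exact (Submodule.Quotient.mk_eq_zero S).2 (Submodule.subset_span ⟨j, rfl⟩)
  obtain ⟨L, hL⟩ := Abelianization.exists_linearMap_rat
    ((QuotientGroup.lift _ f hf).comp e.toMonoidHom)
  have hsurj : Function.Surjective L := by
    rw [← LinearMap.range_eq_top, ← top_le_iff, ← S.range_mkQ, LinearMap.range_eq_map,
      ← (Pi.basisFun ℚ (Fin n)).span_eq, Submodule.map_span, Submodule.span_le]
    rintro _ ⟨_, ⟨i, rfl⟩, rfl⟩
    refine ⟨_, (hL (e.symm (QuotientGroup.mk (FreeGroup.of i)))).trans ?_⟩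
    simp [f, FreeGroup.exponentSum]
  have := LinearMap.finrank_le_finrank_of_surjective hsurj
  omega
end
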